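/- Let α, β be real numbers with −1 ≤ α + β ≤ 1 and β > −1, let k be a positive integer, and let M, N be nonnegative integers. Then, writing the polynomial identity (in the real variable z) ∑_{l ∈ ℤ} C(M+N, M−kl) · C(M+N, N−kl) · ((α+β+1)_{|l|} / (β+1)_{|l|}) · P_{|l|}^{(α,β)}(z − 1) = ∑_{p ≥ 0} c_p · z^p (with only finitely many c_p nonzero), one has c_p ≥ 0 for every p ≥ 1. -/

import Mathlib

/-- Binomial coefficient `C(n, b)` with integer lower index, zero unless `0 ≤ b ≤ n`. -/
def zchoose (n : ℕ) (b : ℤ) : ℕ := if 0 ≤ b then n.choose b.toNat else 0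

/-- The Pochhammer symbol `(a)_m = a (a+1) ⋯ (a+m−1)`. -/
noncomputable def poch (a : ℝ) (m : ℕ) : ℝ := (ascPochhammer ℝ m).eval a

/-- The Jacobi polynomial `P_n^{(α,β)}` evaluated at `z − 1`, via the explicit formula
`P_n^{(α,β)}(z − 1) = ∑_{m=0}^{n} (−1)^{n−m} (n+α+β+1)_m (β+m+1)_{n−m} / (m! (n−m)!) (z/2)^m`. -/
noncomputable def jacobiShift (α β : ℝ) (n : ℕ) (z : ℝ) : ℝ :=
  ∑ m ∈ Finset.range (n + 1),
    (-1 : ℝ) ^ (n - m) *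
      (poch ((n : ℝ) + α + β + 1) m * poch (β + m + 1) (n - m)) /
        ((m.factorial : ℝ) * ((n - m).factorial : ℝ)) * (z / 2) ^ m

open PowerSeries in
/-- The generating function `∑_r C(2r, r + m) X^r` of a column of binomial coefficients. -/
noncomputable def binomColumn (m : ℕ) : PowerSeries ℝ :=
  PowerSeries.mk fun r => ((2 * r).choose (r + m) : ℝ)

namespace binomColumn

open PowerSeries

lemma succ_eq (m : ℕ) :
    binomColumn (m + 1) =
      X * (binomColumn m + 2 * binomColumn (m + 1) + binomColumn (m + 2)) := by
  ext r
  rcases r with _ | r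
  · simp [binomColumn]
  · rw [coeff_succ_X_mul, two_mul]
    simp only [binomColumn, coeff_mk, map_add]
    have h1 : (2 * (r + 1)).choose (r + 1 + (m + 1)) =
        (2 * r).choose (r + m) + (2 * r).choose (r + m + 1) +
          ((2 * r).choose (r + m + 1) + (2 * r).choose (r + m + 2)) := by
      rw [show 2 * (r + 1) = 2 * r + 1 + 1 by ring, show r + 1 + (m + 1) = r + m + 1 + 1 by ring,
        Nat.choose_succ_succ, Nat.choose_succ_succ, Nat.choose_succ_succ]
    rw [h1]
    push_cast
    simp only [← add_assoc]

lemma zero_eq :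
    binomColumn 0 = 1 + X * (2 * binomColumn 0 + 2 * binomColumn 1) := by
  ext r
  rcases r with _ | r
  · simp [binomColumn]
  · rw [map_add, coeff_succ_X_mul, two_mul, two_mul]
    simp only [binomColumn, coeff_mk, map_add]
    have h1 : (2 * (r + 1)).choose (r + 1 + 0) =
        2 * (2 * r).choose (r + 0) + 2 * (2 * r).choose (r + 1) := by
      rcases r with _ | r
      · simp
      · rw [show 2 * (r + 1 + 1) = 2 * (r + 1) + 1 + 1 by ring, add_zero, add_zero,
          Nat.choose_succ_succ (2 * (r + 1) + 1), Nat.choose_succ_succ (2 * (r + 1)) r,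
          Nat.choose_succ_succ (2 * (r + 1)) (r + 1)]
        have : (2 * (r + 1)).choose r = (2 * (r + 1)).choose (r + 1 + 1) :=
          Nat.choose_symm_of_eq_add (by ring)
        rw [this]
        simp only [Nat.succ_eq_add_one]
        ring
    rw [h1]
    simp only [coeff_one, Nat.succ_ne_zero, if_false]
    push_cast
    ring

lemma X_pow_dvd (m : ℕ) : (X : PowerSeries ℝ) ^ m ∣ binomColumn m := by
  rw [X_pow_dvd_iff]
  intro r hr
  simp only [binomColumn, coeff_mk]
  rw [Nat.choose_eq_zero_of_lt (by omega), Nat.cast_zero]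

lemma ne_zero (m : ℕ) : binomColumn m ≠ 0 := by
  intro h
  have := congrArg (coeff m) h
  simp [binomColumn, two_mul] at this

lemma zero_mul_two : binomColumn 0 * binomColumn 2 = binomColumn 1 ^ 2 := by
  have hstep (m : ℕ) : binomColumn (m + 1) * binomColumn (m + 3) - binomColumn (m + 2) ^ 2 =
      binomColumn m * binomColumn (m + 2) - binomColumn (m + 1) ^ 2 := by
    have h1 := succ_eq m
    have h2 := succ_eq (m + 1)
    apply mul_left_cancel₀ (X_ne_zero (R := ℝ))
    linear_combination (-binomColumn (m + 1)) * h2 + binomColumn (m + 2) * h1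
  have hconst (m : ℕ) : binomColumn m * binomColumn (m + 2) - binomColumn (m + 1) ^ 2 =
      binomColumn 0 * binomColumn 2 - binomColumn 1 ^ 2 := by
    induction m with
    | zero => rfl
    | succ m ih => rw [← ih, ← hstep m]
  rw [← sub_eq_zero]
  ext r
  have hdvd : (X : PowerSeries ℝ) ^ (r + 1) ∣ binomColumn 0 * binomColumn 2 - binomColumn 1 ^ 2 := by
    rw [← hconst (r + 1)]
    refine dvd_sub (dvd_mul_of_dvd_left (X_pow_dvd _) _) ?_
    rw [pow_two]
    exact dvd_mul_of_dvd_left ((pow_dvd_pow _ (by omega)).trans (X_pow_dvd _)) _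
  rw [X_pow_dvd_iff] at hdvd
  simpa using hdvd r (by omega)

/-- The common ratio of consecutive columns. -/
noncomputable def ratio : PowerSeries ℝ := binomColumn 1 * (binomColumn 0)⁻¹

lemma ratio_mul_zero : ratio * binomColumn 0 = binomColumn 1 := by
  rw [ratio, mul_assoc, PowerSeries.inv_mul_cancel, mul_one]
  simp [binomColumn]

lemma succ_eq_ratio_mul (m : ℕ) : binomColumn (m + 1) = ratio * binomColumn m := by
  induction m with
  | zero => exact ratio_mul_zero.symm
  | succ m ih =>
    have h1 := succ_eq m
    have h0 := zero_eq
    have h01 := succ_eq 0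
    have hr := ratio_mul_zero
    have hz := zero_mul_two
    apply mul_left_cancel₀ (mul_ne_zero (X_ne_zero (R := ℝ)) (ne_zero 0))
    have hq : ratio * binomColumn 1 = binomColumn 2 := by
      apply mul_left_cancel₀ (ne_zero 0)
      linear_combination binomColumn 1 * hr - hz
    have hc : ratio = X * (1 + 2 * ratio + ratio ^ 2) := by
      apply mul_right_cancel₀ (ne_zero 0)
      linear_combination hr + h01 - X * (2 + ratio) * hr - X * hq
    linear_combination (-binomColumn 0) * h1 + binomColumn 0 * ih - binomColumn 0 * X *
      (2 * ih + ratio * ih) + binomColumn 0 * binomColumn m * hc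

lemma eq_ratio_pow_mul (m : ℕ) : binomColumn m = ratio ^ m * binomColumn 0 := by
  induction m with
  | zero => simp
  | succ m ih => rw [succ_eq_ratio_mul, ih, pow_succ]; ring

lemma ratio_eq : ratio = X * (1 + ratio) ^ 2 := by
  apply mul_right_cancel₀ (ne_zero 0)
  have h := succ_eq 0
  rw [eq_ratio_pow_mul 1, eq_ratio_pow_mul 2] at h
  linear_combination h

lemma constantCoeff_ratio : constantCoeff ratio = 0 := by
  rw [ratio_eq]; simp

lemma zero_mul_one_sub_ratio : binomColumn 0 * (1 - ratio) = 1 + ratio := by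
  have h := zero_eq
  rw [← ratio_mul_zero] at h
  linear_combination (1 + ratio) * h - 2 * binomColumn 0 * ratio_eq

lemma one_sub_ratio_ne_zero : 1 - ratio ≠ 0 := by
  intro h
  simpa [constantCoeff_ratio] using congrArg constantCoeff h

lemma zero_sq_mul : binomColumn 0 ^ 2 * (1 - 4 * X) = 1 := by
  apply mul_right_cancel₀ (pow_ne_zero 2 one_sub_ratio_ne_zero)
  linear_combination (1 - 4 * X) * (binomColumn 0 * (1 - ratio) + (1 + ratio)) *
    zero_mul_one_sub_ratio + 4 * ratio_eq

lemma X_mul_derivative_ratio : X * d⁄dX ℝ ratio = ratio * binomColumn 0 := by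
  have hD := congrArg (d⁄dX ℝ) ratio_eq
  simp only [Derivation.leibniz, Derivation.leibniz_pow, map_add, derivative_X, smul_eq_mul,
    derivative_one, nsmul_eq_mul] at hD
  norm_num at hD
  apply mul_right_cancel₀ one_sub_ratio_ne_zero
  linear_combination (-ratio) * zero_mul_one_sub_ratio + X * (1 + ratio) * hD
    - (2 * X * d⁄dX ℝ ratio + 1 + ratio) * ratio_eq

lemma derivative_zero : (1 - 4 * X) * d⁄dX ℝ (binomColumn 0) = 2 * binomColumn 0 := by
  have hD := congrArg (d⁄dX ℝ) zero_sq_mul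
  have h4 : d⁄dX ℝ (1 - 4 * X : PowerSeries ℝ) = -4 := by
    have : (4 : PowerSeries ℝ) = C (4 : ℝ) := (map_ofNat C 4).symm
    rw [this, map_sub, Derivation.leibniz, derivative_X, derivative_C, derivative_one]
    simp
  rw [Derivation.leibniz, h4, Derivation.leibniz_pow, derivative_one] at hD
  simp only [smul_eq_mul, nsmul_eq_mul] at hD
  norm_num at hD
  have h2 : (2 : PowerSeries ℝ) ≠ 0 := by
    rw [← map_ofNat C 2, ne_eq, ← map_zero C, C_injective.eq_iff]
    norm_num
  apply mul_left_cancel₀ (mul_ne_zero h2 (ne_zero 0))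
  linear_combination hD

/-- The logarithmic derivative `∑_{r ≥ 1} 2·4^{r-1} X^r` of the zeroth column. -/
noncomputable def logDeriv : PowerSeries ℝ := X * (2 * PowerSeries.mk fun r => (4 : ℝ) ^ r)

lemma X_mul_derivative_zero : X * d⁄dX ℝ (binomColumn 0) = logDeriv * binomColumn 0 := by
  have hgeom : (1 - 4 * X) * (PowerSeries.mk fun r => (4 : ℝ) ^ r) = 1 := by
    have h4 : (4 : PowerSeries ℝ) = C (4 : ℝ) := (map_ofNat C 4).symm
    ext r
    rw [h4, sub_mul, one_mul, mul_assoc]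
    rcases r with _ | r
    · simp
    · rw [map_sub, coeff_C_mul, coeff_succ_X_mul, coeff_mk, coeff_mk, coeff_one]
      simp [pow_succ]; ring
  have hne : (1 - 4 * X : PowerSeries ℝ) ≠ 0 := by
    intro h
    simp [h] at hgeom
  apply mul_left_cancel₀ hne
  rw [logDeriv]
  linear_combination X * derivative_zero - 2 * X * binomColumn 0 * hgeom

lemma hasSubst_ratio_pow {k : ℕ} (hk : 0 < k) : HasSubst (ratio ^ k) :=
  HasSubst.of_constantCoeff_zero' (by rw [map_pow, constantCoeff_ratio, zero_pow hk.ne'])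

lemma coeff_zero_mul_subst {k : ℕ} (hk : 0 < k) (G : PowerSeries ℝ) (r : ℕ) :
    coeff r (binomColumn 0 * G.subst (ratio ^ k)) =
      ∑ l ∈ Finset.range (r + 1), coeff l G * ((2 * r).choose (r + k * l) : ℝ) := by
  have hs := hasSubst_ratio_pow hk
  rw [eq_X_pow_mul_shift_add_trunc (r + 1) G, subst_add hs, subst_mul hs, subst_pow hs, subst_X hs,
    subst_coe hs, mul_add, map_add]
  have hdvd : (X : PowerSeries ℝ) ^ (r + 1) ∣ (ratio ^ k) ^ (r + 1) := by
    refine pow_dvd_pow_of_dvd (dvd_pow ?_ hk.ne') _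
    rw [X_dvd_iff, constantCoeff_ratio]
  rw [X_pow_dvd_iff.1 ((hdvd.mul_right _).mul_left _) r (by omega), zero_add,
    ← eq_X_pow_mul_shift_add_trunc, Polynomial.aeval_eq_sum_range' (n := r + 1), Finset.mul_sum,
    map_sum]
  · refine Finset.sum_congr rfl fun l hl => ?_
    rw [coeff_trunc, if_pos (Finset.mem_range.1 hl), mul_smul_comm, map_smul, smul_eq_mul,
      ← pow_mul, mul_comm (binomColumn 0), ← eq_ratio_pow_mul]
    simp [binomColumn]
  · exact natDegree_trunc_lt _ _

/-- If `G` has logarithmic derivative `P`, then `b₀ · G(cᵏ)` has logarithmic derivative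
`σ + k b₀ · P(cᵏ)`, where `c` is the ratio of the columns and `σ` that of `b₀`. -/
lemma X_mul_derivative_zero_mul_subst {k : ℕ} (hk : 0 < k) {G P : PowerSeries ℝ}
    (h : X * d⁄dX ℝ G = P * G) :
    X * d⁄dX ℝ (binomColumn 0 * G.subst (ratio ^ k)) =
      (logDeriv + (k : PowerSeries ℝ) * (binomColumn 0 * P.subst (ratio ^ k))) *
        (binomColumn 0 * G.subst (ratio ^ k)) := by
  have hs := hasSubst_ratio_pow hk
  have h' := congrArg (fun f => PowerSeries.subst (ratio ^ k) f) h
  simp only [subst_mul hs, subst_X hs] at h'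
  rw [Derivation.leibniz, derivative_subst hs, Derivation.leibniz_pow]
  simp only [smul_eq_mul, nsmul_eq_mul]
  have hr := X_mul_derivative_ratio
  have h0 := X_mul_derivative_zero
  obtain ⟨j, rfl⟩ : ∃ j, k = j + 1 := ⟨k - 1, by omega⟩
  simp only [Nat.add_sub_cancel]
  linear_combination PowerSeries.subst (ratio ^ (j + 1)) G * h0 +
    binomColumn 0 * PowerSeries.subst (ratio ^ (j + 1)) (d⁄dX ℝ G) * ((j + 1 : ℕ) : PowerSeries ℝ) *
      ratio ^ j * hr + binomColumn 0 ^ 2 * ((j + 1 : ℕ) : PowerSeries ℝ) * h'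

end binomColumn

/-- The sums of the entries of row `2 i` of Pascal's triangle over residue classes modulo `2 k`,
indexed by the offset from the central entry. -/
def foldedRow (k : ℕ) : ℕ → ℤ → ℝ
  | 0, x => if (2 * k : ℤ) ∣ x then 1 else 0
  | i + 1, x => foldedRow k i (x - 1) + 2 * foldedRow k i x + foldedRow k i (x + 1)

namespace foldedRow

variable {k : ℕ}

lemma add_period (i : ℕ) (x : ℤ) : foldedRow k i (x + 2 * k) = foldedRow k i x := by
  induction i generalizing x with
  | zero => simp [foldedRow]
  | succ i ih =>
    simp only [foldedRow]
    rw [ih x, show x + 2 * (k : ℤ) - 1 = x - 1 + 2 * k by ring,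
      show x + 2 * (k : ℤ) + 1 = x + 1 + 2 * k by ring, ih, ih]

lemma neg (i : ℕ) (x : ℤ) : foldedRow k i (-x) = foldedRow k i x := by
  induction i generalizing x with
  | zero => simp [foldedRow]
  | succ i ih =>
    simp only [foldedRow]
    rw [ih x, show -x - 1 = -(x + 1) by ring, show -x + 1 = -(x - 1) by ring, ih, ih]
    ring

lemma reflect (i : ℕ) (x : ℤ) : foldedRow k i (2 * k - x) = foldedRow k i x := by
  rw [← neg i x, ← add_period i (-x)]
  congr 1
  ring

lemma succ_le (i x : ℕ) (hx : x < k) : foldedRow k i (x + 1) ≤ foldedRow k i x := by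
  induction i generalizing x with
  | zero =>
    simp only [foldedRow]
    have h : ¬ (2 * k : ℤ) ∣ (x + 1 : ℤ) := by
      intro h
      have := Int.le_of_dvd (by omega) h
      omega
    rw [if_neg h]
    split_ifs <;> norm_num
  | succ i ih =>
    simp only [foldedRow]
    have h0 := ih x hx
    have hl : foldedRow k i (x + 1) - foldedRow k i x ≤
        foldedRow k i (x - 1) - foldedRow k i x := by
      rcases x with _ | x
      · have := neg (k := k) i 1
        norm_num at this ⊢
        rw [this]
      · have := ih x (by omega)
        push_cast
        rw [add_sub_cancel_right]
        push_cast at h0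
        linarith
    have hr : foldedRow k i (x + 1 + 1) - foldedRow k i (x + 1) ≤
        foldedRow k i x - foldedRow k i (x + 1) := by
      rcases Nat.lt_or_ge (x + 1) k with h | h
      · have := ih (x + 1) h
        push_cast at this
        linarith
      · obtain rfl : k = x + 1 := by omega
        have := reflect (k := x + 1) i x
        push_cast at this
        rw [← this, show 2 * ((x : ℤ) + 1) - x = x + 1 + 1 by ring]
    rw [add_sub_cancel_right]
    linarith

lemma antitone (i : ℕ) {x y : ℕ} (hxy : x ≤ y) (hy : y ≤ k) :
    foldedRow k i y ≤ foldedRow k i x := by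
  induction y, hxy using Nat.le_induction with
  | base => rfl
  | succ y hxy ih => 
    refine le_trans ?_ (ih (by omega))
    exact_mod_cast succ_le i y (by omega)

lemma half_period_le (i : ℕ) {x : ℕ} (hx : x < 2 * k) : foldedRow k i k ≤ foldedRow k i x := by
  rcases Nat.le_total x k with h | h
  · exact antitone i h le_rfl
  · rw [← reflect i (x : ℤ)]
    have := antitone (k := k) i (x := 2 * k - x) (y := k) (by omega) le_rfl
    rwa [Nat.cast_sub hx.le, Nat.cast_mul, Nat.cast_ofNat] at this

lemma sum_period (hk : 0 < k) (i : ℕ) :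
    ∑ x ∈ Finset.range (2 * k), foldedRow k i x = 4 ^ i := by
  induction i with
  | zero =>
    rw [Finset.sum_eq_single_of_mem 0 (by simp [hk])]
    · simp [foldedRow]
    · intro x hx h0
      have : ¬ (2 * k : ℤ) ∣ (x : ℤ) := by
        intro h
        have := Int.le_of_dvd (by omega) h
        simp at hx
        omega
      simp [foldedRow, this]
  | succ i ih =>
    have hshift (g : ℤ → ℝ) (hg : ∀ x, g (x + 2 * k) = g x) :
        ∑ x ∈ Finset.range (2 * k), g (x + 1) = ∑ x ∈ Finset.range (2 * k), g x := by
      have h1 := Finset.sum_range_succ (fun x : ℕ => g x) (2 * k)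
      have h2 := Finset.sum_range_succ' (fun x : ℕ => g x) (2 * k)
      have h3 := hg 0
      push_cast at h1 h2
      rw [zero_add] at h3
      linarith
    have h1 := hshift (foldedRow k i) (add_period i)
    have h2 := hshift (fun x => foldedRow k i (x - 1)) fun x => by
      rw [← add_period i (x - 1)]
      congr 1
      ring
    simp only [add_sub_cancel_right] at h2
    simp only [foldedRow, Finset.sum_add_distrib, ← Finset.mul_sum]
    rw [h1, ← h2, ih, pow_succ]
    ring

lemma half_period_mul_le (hk : 0 < k) (i : ℕ) : 2 * k * foldedRow k i k ≤ 4 ^ i := by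
  rw [← sum_period hk i]
  calc 2 * k * foldedRow k i k = ∑ x ∈ Finset.range (2 * k), foldedRow k i k := by simp
    _ ≤ _ := Finset.sum_le_sum fun x hx => half_period_le i (Finset.mem_range.1 hx)

lemma sum_choose_shift (δ : ℤ → ℝ) (n : ℕ) (x : ℤ) :
    ∑ j ∈ Finset.range (n + 2), ((n + 1).choose j : ℝ) * δ (x - j) =
      ∑ j ∈ Finset.range (n + 1), (n.choose j : ℝ) * δ (x - j) +
        ∑ j ∈ Finset.range (n + 1), (n.choose j : ℝ) * δ (x - 1 - j) := by
  rw [Finset.sum_choose_succ_mul (fun j _ => δ (x - j)) n]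
  simp only [Nat.cast_add, Nat.cast_one, sub_sub, add_comm (1 : ℤ)]

lemma eq_sum (i : ℕ) (x : ℤ) :
    foldedRow k i x = ∑ j ∈ Finset.range (2 * i + 1),
      ((2 * i).choose j : ℝ) * foldedRow k 0 (x + i - j) := by
  induction i generalizing x with
  | zero => simp
  | succ i ih =>
    rw [show 2 * (i + 1) + 1 = 2 * i + 1 + 2 by ring, show 2 * (i + 1) = 2 * i + 1 + 1 by ring,
      sum_choose_shift, sum_choose_shift, sum_choose_shift]
    rw [foldedRow, ih, ih, ih]
    push_cast
    rw [show x + ((i : ℤ) + 1) - 1 - 1 = x - 1 + i by ring,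
      show x + ((i : ℤ) + 1) - 1 = x + i by ring, show x + ((i : ℤ) + 1) = x + 1 + i by ring]
    ring

lemma sum_choose_even (i : ℕ) (h : ℤ → ℝ) (heven : ∀ x, h (-x) = h x) :
    ∑ j ∈ Finset.range (2 * i + 1), ((2 * i).choose j : ℝ) * h (i - j) =
      ((2 * i).choose i : ℝ) * h 0 +
        2 * ∑ m ∈ Finset.range i, ((2 * i).choose (i + (m + 1)) : ℝ) * h ((m + 1 : ℕ) : ℤ) := by
  have h1 : ∑ j ∈ Finset.range i, ((2 * i).choose j : ℝ) * h (i - j) =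
      ∑ m ∈ Finset.range i, ((2 * i).choose (i + (m + 1)) : ℝ) * h ((m + 1 : ℕ) : ℤ) := by
    rw [← Finset.sum_range_reflect]
    refine Finset.sum_congr rfl fun m hm => ?_
    have hm := Finset.mem_range.1 hm
    rw [Nat.choose_symm_of_eq_add (show 2 * i = i - 1 - m + (i + (m + 1)) by omega)]
    congr 2
    omega
  have h2 : ∑ m ∈ Finset.range i, ((2 * i).choose (i + 1 + m) : ℝ) * h (i - (i + 1 + m : ℕ)) =
      ∑ m ∈ Finset.range i, ((2 * i).choose (i + (m + 1)) : ℝ) * h ((m + 1 : ℕ) : ℤ) := by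
    refine Finset.sum_congr rfl fun m hm => ?_
    rw [show i + 1 + m = i + (m + 1) by ring, ← heven]
    congr 2
    push_cast
    ring
  rw [show 2 * i + 1 = (i + 1) + i by ring, Finset.sum_range_add, Finset.sum_range_succ, h1, h2,
    sub_self]
  ring

lemma zero_sub_half_period (hk : 0 < k) (i : ℕ) :
    foldedRow k i 0 - foldedRow k i k = ((2 * i).choose i : ℝ) +
      2 * ∑ l ∈ Finset.range i, (-1) ^ (l + 1) * ((2 * i).choose (i + k * (l + 1)) : ℝ) := by
  set χ : ℤ → ℝ := fun x => foldedRow k 0 x - foldedRow k 0 (k + x) with hχ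
  have hχ_even (x : ℤ) : χ (-x) = χ x := by
    simp only [hχ]
    rw [neg, ← reflect 0 (k + -x : ℤ)]
    congr 2
    ring
  have hχ_mul (l : ℕ) : χ ((k * l : ℕ) : ℤ) = (-1) ^ l := by
    have hk' : (k : ℤ) ≠ 0 := by omega
    have h1 : (2 * k : ℤ) ∣ ((k * l : ℕ) : ℤ) ↔ Even l := by
      push_cast
      rw [mul_comm (2 : ℤ), mul_dvd_mul_iff_left hk', even_iff_two_dvd]
      exact_mod_cast Iff.rfl
    have h2 : (2 * k : ℤ) ∣ k + ((k * l : ℕ) : ℤ) ↔ Even (l + 1) := by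
      push_cast
      rw [show (k : ℤ) + k * l = k * (l + 1) by ring, mul_comm (2 : ℤ), mul_dvd_mul_iff_left hk',
        even_iff_two_dvd]
      exact_mod_cast Iff.rfl
    simp only [hχ, foldedRow, h1, h2]
    rcases Nat.even_or_odd l with h | h
    · simp [h, Nat.even_add_one, h.neg_one_pow]
    · simp [Nat.not_even_iff_odd.2 h, Nat.even_add_one, h.neg_one_pow]
  have hχ_zero (x : ℕ) (hx : ¬ k ∣ x) : χ x = 0 := by
    have h1 : ¬ (2 * k : ℤ) ∣ x := fun h =>
      hx (by exact_mod_cast (Dvd.intro_left (2 : ℤ) rfl : (k : ℤ) ∣ 2 * k).trans h)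
    have h2 : ¬ (2 * k : ℤ) ∣ k + x := fun h =>
      hx (by
        have := (Dvd.intro_left (2 : ℤ) rfl : (k : ℤ) ∣ 2 * k).trans h
        rw [dvd_add_right dvd_rfl] at this
        exact_mod_cast this)
    simp [hχ, foldedRow, h1, h2]
  have hsum : foldedRow k i 0 - foldedRow k i k =
      ∑ j ∈ Finset.range (2 * i + 1), ((2 * i).choose j : ℝ) * χ (i - j) := by
    rw [eq_sum i 0, eq_sum i k, ← Finset.sum_sub_distrib]
    refine Finset.sum_congr rfl fun j _ => ?_
    simp only [hχ, zero_add, add_sub_assoc]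
    ring
  rw [hsum, sum_choose_even i χ hχ_even]
  have h0 := hχ_mul 0
  simp only [Nat.mul_zero, Nat.cast_zero, pow_zero] at h0
  rw [h0, mul_one]
  congr 2
  have hext : ∑ m ∈ Finset.range i, ((2 * i).choose (i + (m + 1)) : ℝ) * χ ((m + 1 : ℕ) : ℤ) =
      ∑ m ∈ Finset.range (k * i), ((2 * i).choose (i + (m + 1)) : ℝ) * χ ((m + 1 : ℕ) : ℤ) := by
    refine Finset.sum_subset (Finset.range_mono (Nat.le_mul_of_pos_left i hk)) fun m _ hm => ?_
    rw [Finset.mem_range] at hm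
    rw [Nat.choose_eq_zero_of_lt (by omega), Nat.cast_zero, zero_mul]
  have hpos (l : ℕ) : k * (l + 1) - 1 + 1 = k * (l + 1) :=
    Nat.sub_add_cancel (Nat.mul_pos hk l.succ_pos)
  rw [hext]
  symm
  refine Finset.sum_of_injOn (fun l => k * (l + 1) - 1) ?_ ?_ ?_ ?_
  · intro a _ b _ hab
    have h : k * (a + 1) - 1 + 1 = k * (b + 1) - 1 + 1 := congrArg (· + 1) hab
    rw [hpos, hpos] at h
    simpa using Nat.eq_of_mul_eq_mul_left hk h
  · intro l hl
    simp only [Finset.coe_range, Set.mem_Iio] at hl ⊢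
    have := hpos l
    have := Nat.mul_le_mul_left k (Nat.succ_le_of_lt hl)
    simp only [Nat.succ_eq_add_one] at this
    omega
  · intro m hm hm'
    rw [hχ_zero, mul_zero]
    rintro ⟨l, hl⟩
    apply hm'
    rcases l with _ | l
    · simp at hl
    · refine ⟨l, ?_, by simp only [← hl, Nat.add_sub_cancel]⟩
      simp only [Finset.coe_range, Set.mem_Iio, Finset.mem_range] at hm ⊢
      have : k * (l + 1) ≤ k * i := by omega
      exact Nat.lt_of_succ_le (Nat.le_of_mul_le_mul_left this hk)
  · intro l _
    rw [hpos, hχ_mul, mul_comm]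

lemma centralBinom_le_zero (i : ℕ) : ((2 * i).choose i : ℝ) ≤ foldedRow k i 0 := by
  rw [eq_sum]
  have hnn (j : ℕ) : 0 ≤ ((2 * i).choose j : ℝ) * foldedRow k 0 (0 + i - j) := by
    simp only [foldedRow]
    split_ifs <;> positivity
  refine le_trans (le_of_eq ?_)
    (Finset.single_le_sum (fun j _ => hnn j) (Finset.mem_range.2 (by omega : i < 2 * i + 1)))
  simp [foldedRow]

end foldedRow

lemma centralBinom_add_alternating_nonneg {k : ℕ} (hk : 0 < k) (i : ℕ) :
    0 ≤ ((2 * i).choose i : ℝ) +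
      2 * ∑ l ∈ Finset.range i, (-1) ^ (l + 1) * ((2 * i).choose (i + k * (l + 1)) : ℝ) := by
  rw [← foldedRow.zero_sub_half_period hk, sub_nonneg]
  exact foldedRow.half_period_le i (x := 0) (by omega)

lemma four_pow_add_alternating_nonneg {k : ℕ} (hk : 0 < k) (i : ℕ) :
    0 ≤ (4 : ℝ) ^ i +
      4 * k * ∑ l ∈ Finset.range i, (-1) ^ (l + 1) * ((2 * i).choose (i + k * (l + 1)) : ℝ) := by
  have h1 := foldedRow.zero_sub_half_period hk i
  have h2 := foldedRow.half_period_mul_le hk i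
  have h3 := foldedRow.centralBinom_le_zero (k := k) i
  have h4 : 0 ≤ 2 * (k : ℝ) * (foldedRow k i 0 - ((2 * i).choose i : ℝ)) :=
    mul_nonneg (by positivity) (by linarith)
  linear_combination h4 + h2 + 2 * (k : ℝ) * h1

lemma poch_succ (a : ℝ) (m : ℕ) : poch a (m + 1) = poch a m * (a + m) := by
  simp [poch, ascPochhammer_succ_eval]

lemma poch_add (a : ℝ) (m n : ℕ) : poch a (m + n) = poch a m * poch (a + m) n := by
  rw [poch, ← ascPochhammer_mul]
  simp [poch]

lemma poch_nonneg {a : ℝ} (ha : 0 ≤ a) (m : ℕ) : 0 ≤ poch a m := by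
  induction m with
  | zero => simp [poch]
  | succ m ih => rw [poch_succ]; positivity

/-- The coefficients of `(e)_{2p} X^p (1 + X)^{-(2p+e)}`. -/
noncomputable def binomialCoeff (e : ℝ) (p l : ℕ) : ℝ :=
  if p ≤ l then (-1) ^ (l - p) * poch e (l + p) / (l - p).factorial else 0

lemma binomialCoeff_succ (e : ℝ) (p l : ℕ) :
    ((l : ℝ) + 1 - p) * binomialCoeff e p (l + 1) = -(e + l + p) * binomialCoeff e p l := by
  rcases lt_trichotomy p (l + 1) with h | rfl | h
  · obtain ⟨s, rfl⟩ := Nat.exists_eq_add_of_le (Nat.le_of_lt_succ h)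
    rw [binomialCoeff, binomialCoeff, if_pos (by omega), if_pos (by omega),
      show p + s + 1 - p = s + 1 by omega, show p + s - p = s by omega,
      show p + s + 1 + p = p + s + p + 1 by ring, poch_succ, Nat.factorial_succ, pow_succ]
    have : (s.factorial : ℝ) ≠ 0 := by positivity
    push_cast
    field_simp
    ring
  · simp [binomialCoeff]
  · simp [binomialCoeff, h.not_ge, (Nat.lt_of_succ_lt h).not_ge]

open PowerSeries in
/-- The logarithmic derivative `p - (2p+e) X / (1 + X)` of `X^p (1 + X)^{-(2p+e)}`. -/
noncomputable def binomialLogDeriv (e : ℝ) (p : ℕ) : PowerSeries ℝ :=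
  PowerSeries.mk fun l => if l = 0 then (p : ℝ) else (2 * p + e) * (-1) ^ l

open PowerSeries in
lemma X_mul_derivative_binomialCoeff (e : ℝ) (p : ℕ) :
    X * d⁄dX ℝ (PowerSeries.mk (binomialCoeff e p)) =
      binomialLogDeriv e p * PowerSeries.mk (binomialCoeff e p) := by
  have hP : (1 + X) * binomialLogDeriv e p = C (p : ℝ) - C (p + e) * X := by
    ext l
    rw [add_mul, one_mul]
    rcases l with _ | _ | l
    · simp [binomialLogDeriv]
    · rw [map_add, coeff_succ_X_mul, map_sub, coeff_succ_mul_X]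
      simp [binomialLogDeriv, -map_natCast]
      ring
    · rw [map_add, coeff_succ_X_mul, map_sub, coeff_succ_mul_X]
      simp [binomialLogDeriv, -map_natCast, pow_succ]
  have hG : (1 + X) * (X * d⁄dX ℝ (PowerSeries.mk (binomialCoeff e p))) =
      (C (p : ℝ) - C (p + e) * X) * PowerSeries.mk (binomialCoeff e p) := by
    ext l
    rw [add_mul, one_mul, sub_mul, mul_assoc (C _)]
    rcases l with _ | _ | l
    · rcases p with _ | p <;> simp [binomialCoeff]
    · have h := binomialCoeff_succ e p 0
      rw [map_add, coeff_succ_X_mul, map_sub, coeff_C_mul, coeff_C_mul, coeff_succ_X_mul,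
        coeff_succ_X_mul]
      simp only [coeff_derivative, coeff_mk, coeff_zero_X_mul]
      push_cast at h ⊢
      linear_combination h
    · have h := binomialCoeff_succ e p (l + 1)
      rw [map_add, coeff_succ_X_mul, map_sub, coeff_C_mul, coeff_C_mul, coeff_succ_X_mul,
        coeff_succ_X_mul, coeff_succ_X_mul]
      simp only [coeff_derivative, coeff_mk]
      push_cast at h ⊢
      linear_combination h
  have hne : (1 + X : PowerSeries ℝ) ≠ 0 := by
    intro h
    simpa using congrArg constantCoeff h
  apply mul_left_cancel₀ hne
  rw [hG, ← hP]
  ring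

open PowerSeries in
/-- A power series starting with a nonnegative coefficient in degree `q` is nonnegative if its
logarithmic derivative has nonnegative coefficients in positive degrees. -/
lemma coeff_nonneg_of_logDeriv {F L : PowerSeries ℝ} {q : ℕ}
    (h : X * d⁄dX ℝ F = L * F) (hL0 : coeff 0 L = q) (hL : ∀ i, 0 < i → 0 ≤ coeff i L)
    (hlt : ∀ r < q, coeff r F = 0) (hq : 0 ≤ coeff q F) (r : ℕ) : 0 ≤ coeff r F := by
  induction r using Nat.strong_induction_on with
  | _ r ih =>
    rcases lt_trichotomy r q with hr | rfl | hr
    · exact (hlt r hr).ge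
    · exact hq
    · have hc := congrArg (coeff r) h
      obtain ⟨s, rfl⟩ : ∃ s, r = s + 1 := ⟨r - 1, by omega⟩
      rw [coeff_succ_X_mul, coeff_derivative, coeff_mul, Finset.Nat.sum_antidiagonal_succ,
        hL0] at hc
      have hnn : 0 ≤ ∑ x ∈ Finset.HasAntidiagonal.antidiagonal s, coeff (x.1 + 1) L * coeff x.2 F :=
        Finset.sum_nonneg fun x hx => mul_nonneg (hL _ (by omega))
          (ih _ (by have := Finset.HasAntidiagonal.mem_antidiagonal.1 hx; omega))
      have hpos : (0 : ℝ) < s + 1 - q := by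
        have : (q : ℝ) < ((s + 1 : ℕ) : ℝ) := by exact_mod_cast hr
        push_cast at this
        linarith
      refine nonneg_of_mul_nonneg_right ?_ hpos
      linarith

open PowerSeries in
lemma sum_binomialCoeff_mul_choose_nonneg {e : ℝ} (he0 : 0 ≤ e) (he2 : e ≤ 2) {k : ℕ} (hk : 0 < k)
    (p r : ℕ) :
    0 ≤ ∑ l ∈ Finset.range (r + 1), binomialCoeff e p l * ((2 * r).choose (r + k * l) : ℝ) := by
  have hF (r : ℕ) := binomColumn.coeff_zero_mul_subst hk (PowerSeries.mk (binomialCoeff e p)) r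
  have hP (r : ℕ) := binomColumn.coeff_zero_mul_subst hk (binomialLogDeriv e p) r
  simp only [coeff_mk] at hF
  rw [← hF]
  have hterm (r l : ℕ) (hr : r ≤ k * p) (hl : r < k * p ∨ l ≠ p) :
      binomialCoeff e p l * ((2 * r).choose (r + k * l) : ℝ) = 0 := by
    rcases lt_or_ge l p with h | h
    · rw [binomialCoeff, if_neg h.not_ge, zero_mul]
    · have hlt : r < k * l := by
        rcases hl with hl | hl
        · exact hl.trans_le (Nat.mul_le_mul_left k h)
        · exact hr.trans_lt (Nat.mul_lt_mul_of_pos_left (lt_of_le_of_ne h hl.symm) hk)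
      rw [Nat.choose_eq_zero_of_lt (by omega), Nat.cast_zero, mul_zero]
  refine coeff_nonneg_of_logDeriv (q := k * p) (binomColumn.X_mul_derivative_zero_mul_subst hk
    (X_mul_derivative_binomialCoeff e p)) ?_ (fun i hi => ?_) (fun r hr => ?_) ?_ r
  · rw [← map_natCast C k, map_add, coeff_C_mul, hP, binomColumn.logDeriv, coeff_zero_X_mul]
    simp [binomialLogDeriv]
  · obtain ⟨j, rfl⟩ : ∃ j, i = j + 1 := ⟨i - 1, by omega⟩
    have h2 : (2 : PowerSeries ℝ) = C (2 : ℝ) := (map_ofNat C 2).symm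
    rw [← map_natCast C k, map_add, coeff_C_mul, hP, binomColumn.logDeriv, coeff_succ_X_mul, h2,
      coeff_C_mul, coeff_mk, Finset.sum_range_succ']
    have h1 := centralBinom_add_alternating_nonneg hk (j + 1)
    have h3 := four_pow_add_alternating_nonneg hk (j + 1)
    simp only [binomialLogDeriv, coeff_mk, Nat.succ_ne_zero, if_false, if_true, mul_assoc,
      ← Finset.mul_sum, mul_zero, add_zero]
    set S := ∑ l ∈ Finset.range (j + 1), (-1 : ℝ) ^ (l + 1) *
      ((2 * (j + 1)).choose (j + 1 + k * (l + 1)) : ℝ)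
    rw [pow_succ] at h3
    have h4 : 0 ≤ (k : ℝ) * p * (((2 * (j + 1)).choose (j + 1) : ℝ) + 2 * S) :=
      mul_nonneg (by positivity) h1
    have h5 : 0 ≤ e / 4 * ((4 : ℝ) ^ j * 4 + 4 * k * S) := mul_nonneg (by positivity) h3
    have h6 : 0 ≤ (2 - e) * (4 : ℝ) ^ j := mul_nonneg (by linarith) (by positivity)
    linear_combination h4 + h5 + h6
  · rw [hF]
    exact Finset.sum_eq_zero fun l _ => hterm r l hr.le (Or.inl hr)
  · rw [hF, Finset.sum_eq_single_of_mem p]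
    · rw [binomialCoeff, if_pos le_rfl]
      have := poch_nonneg he0 (p + p)
      simp only [Nat.sub_self, pow_zero, one_mul]
      positivity
    · exact Finset.mem_range.2 (Nat.lt_succ_of_le (Nat.le_mul_of_pos_left p hk))
    · exact fun l _ hl => hterm _ l le_rfl (Or.inr hl)

lemma zchoose_symm (n : ℕ) (x : ℤ) : zchoose n (n - x) = zchoose n x := by
  simp only [zchoose]
  rcases lt_or_ge x 0 with h0 | h0
  · rw [if_pos (by omega), if_neg (by omega), Nat.choose_eq_zero_of_lt (by omega)]
  · rcases lt_or_ge (n : ℤ) x with hn | hn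
    · rw [if_neg (by omega), if_pos h0, Nat.choose_eq_zero_of_lt (by omega)]
    · rw [if_pos (by omega), if_pos h0]
      exact Nat.choose_symm_of_eq_add (by omega)

/-- The coefficient of `t^{2M} y^{2r}` in `(1 + y t + t²)^{M+N}`. -/
noncomputable def trinomialCoeff (M N r : ℕ) : ℝ :=
  if r ≤ M ∧ r ≤ N then
    ((M + N).factorial : ℝ) / ((2 * r).factorial * (M - r).factorial * (N - r).factorial)
  else 0

lemma trinomialCoeff_nonneg (M N r : ℕ) : 0 ≤ trinomialCoeff M N r := by
  rw [trinomialCoeff]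
  split_ifs <;> positivity

lemma trinomialCoeff_mul_choose {M N j i : ℕ} (hM : j ≤ M) (hi : j + i ≤ N) :
    trinomialCoeff M N (j + i) * ((2 * (j + i)).choose (j + i + j) : ℝ) =
      ((M + N).choose (M - j) : ℝ) * ((M - j).choose i * (N + j).choose (N - j - i)) := by
  rw [trinomialCoeff]
  rcases lt_or_ge M (j + i) with h | h
  · rw [if_neg (by omega), Nat.choose_eq_zero_of_lt (show M - j < i by omega)]
    simp
  · rw [if_pos ⟨h, hi⟩, Nat.cast_choose ℝ (show M - j ≤ M + N by omega),
      Nat.cast_choose ℝ (show i ≤ M - j by omega),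
      Nat.cast_choose ℝ (show N - j - i ≤ N + j by omega),
      Nat.cast_choose ℝ (show j + i + j ≤ 2 * (j + i) by omega),
      show M + N - (M - j) = N + j by omega, show N + j - (N - j - i) = j + i + j by omega,
      show 2 * (j + i) - (j + i + j) = i by omega, show M - j - i = M - (j + i) by omega,
      show N - j - i = N - (j + i) by omega]
    have h1 : ((2 * (j + i)).factorial : ℝ) ≠ 0 := by positivity
    have h2 : ((M - j).factorial : ℝ) ≠ 0 := by positivity
    have h3 : ((N + j).factorial : ℝ) ≠ 0 := by positivity
    field_simp

lemma zchoose_mul_zchoose (M N j : ℕ) :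
    (zchoose (M + N) ((M : ℤ) - j) : ℝ) * zchoose (M + N) ((N : ℤ) - j) =
      ∑ r ∈ Finset.range (M + N + 1), trinomialCoeff M N r * ((2 * r).choose (r + j) : ℝ) := by
  by_cases h : j ≤ M ∧ j ≤ N
  · obtain ⟨hM, hN⟩ := h
    have hsub : ∑ r ∈ Finset.range (j + (N - j + 1)),
          trinomialCoeff M N r * ((2 * r).choose (r + j) : ℝ) =
        ∑ r ∈ Finset.range (M + N + 1), trinomialCoeff M N r * ((2 * r).choose (r + j) : ℝ) := by
      refine Finset.sum_subset (Finset.range_mono (by omega)) fun r _ hr => ?_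
      rw [Finset.mem_range] at hr
      rw [trinomialCoeff, if_neg (by omega), zero_mul]
    have hlow : ∑ r ∈ Finset.range j, trinomialCoeff M N r * ((2 * r).choose (r + j) : ℝ) = 0 := by
      refine Finset.sum_eq_zero fun r hr => ?_
      rw [Finset.mem_range] at hr
      rw [Nat.choose_eq_zero_of_lt (by omega), Nat.cast_zero, mul_zero]
    have hvan : (M + N).choose (N - j) = ∑ i ∈ Finset.range (N - j + 1),
        (M - j).choose i * (N + j).choose (N - j - i) := by
      rw [show M + N = M - j + (N + j) by omega, Nat.add_choose_eq,
        Finset.Nat.sum_antidiagonal_eq_sum_range_succ_mk]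
    rw [← hsub, Finset.sum_range_add, hlow, zero_add, zchoose, zchoose, if_pos (by omega),
      if_pos (by omega), show ((M : ℤ) - j).toNat = M - j by omega,
      show ((N : ℤ) - j).toNat = N - j by omega, hvan, Nat.cast_sum, Finset.mul_sum]
    refine Finset.sum_congr rfl fun i hi => ?_
    rw [Finset.mem_range] at hi
    rw [trinomialCoeff_mul_choose hM (by omega), Nat.cast_mul]
  · have h0 : (zchoose (M + N) ((M : ℤ) - j) : ℝ) * zchoose (M + N) ((N : ℤ) - j) = 0 := by
      simp only [zchoose]
      rcases not_and_or.1 h with h | h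
      · rw [if_neg (by omega)]; simp
      · rw [if_neg (show ¬ 0 ≤ (N : ℤ) - j by omega)]; simp
    rw [h0]
    refine (Finset.sum_eq_zero fun r _ => ?_).symm
    by_cases hr : r ≤ M ∧ r ≤ N
    · rw [Nat.choose_eq_zero_of_lt (by omega), Nat.cast_zero, mul_zero]
    · rw [trinomialCoeff, if_neg hr, zero_mul]

lemma sum_zchoose_mul_binomialCoeff_nonneg {e : ℝ} (he0 : 0 ≤ e) (he2 : e ≤ 2) {k : ℕ}
    (hk : 0 < k) (M N p : ℕ) :
    0 ≤ ∑ l ∈ Finset.range (M + N + 1), (zchoose (M + N) ((M : ℤ) - k * l) : ℝ) *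
      zchoose (M + N) ((N : ℤ) - k * l) * binomialCoeff e p l := by
  have h (l : ℕ) := zchoose_mul_zchoose M N (k * l)
  simp only [Nat.cast_mul] at h
  simp only [h, Finset.sum_mul]
  rw [Finset.sum_comm]
  refine Finset.sum_nonneg fun r hr => ?_
  have hsub : ∑ l ∈ Finset.range (r + 1), binomialCoeff e p l * ((2 * r).choose (r + k * l) : ℝ) =
      ∑ l ∈ Finset.range (M + N + 1),
        binomialCoeff e p l * ((2 * r).choose (r + k * l) : ℝ) := by
    refine Finset.sum_subset (Finset.range_mono (by simpa using hr)) fun l _ hl => ?_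
    rw [Finset.mem_range] at hl
    have : l ≤ k * l := Nat.le_mul_of_pos_left l hk
    rw [Nat.choose_eq_zero_of_lt (by omega), Nat.cast_zero, mul_zero]
  have hnn := mul_nonneg (trinomialCoeff_nonneg M N r)
    (sum_binomialCoeff_mul_choose_nonneg he0 he2 hk p r)
  rw [hsub, Finset.mul_sum] at hnn
  refine hnn.trans_eq (Finset.sum_congr rfl fun l _ => ?_)
  ring

/-- The polynomial whose evaluation is `jacobiShift`. -/
noncomputable def jacobiShiftPoly (α β : ℝ) (n : ℕ) : Polynomial ℝ :=
  ∑ m ∈ Finset.range (n + 1), Polynomial.monomial m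
    ((-1 : ℝ) ^ (n - m) * (poch ((n : ℝ) + α + β + 1) m * poch (β + m + 1) (n - m)) /
      ((m.factorial : ℝ) * ((n - m).factorial : ℝ)) / 2 ^ m)

lemma eval_jacobiShiftPoly (α β : ℝ) (n : ℕ) (z : ℝ) :
    (jacobiShiftPoly α β n).eval z = jacobiShift α β n z := by
  rw [jacobiShiftPoly, jacobiShift, Polynomial.eval_finsetSum]
  refine Finset.sum_congr rfl fun m _ => ?_
  rw [Polynomial.eval_monomial, div_pow]
  ring

lemma poch_pos {a : ℝ} (ha : 0 < a) (m : ℕ) : 0 < poch a m := ascPochhammer_pos m a ha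

lemma coeff_jacobiShiftPoly (α : ℝ) {β : ℝ} (hβ : -1 < β) (n p : ℕ) :
    poch (α + β + 1) n / poch (β + 1) n * (jacobiShiftPoly α β n).coeff p =
      binomialCoeff (α + β + 1) p n / (p.factorial * 2 ^ p * poch (β + 1) p) := by
  have hpos (m : ℕ) : poch (β + 1) m ≠ 0 := (poch_pos (by linarith) m).ne'
  rw [jacobiShiftPoly, Polynomial.finsetSum_coeff]
  simp only [Polynomial.coeff_monomial, Finset.sum_ite_eq', Finset.mem_range, Nat.lt_succ_iff]
  rw [binomialCoeff]
  split_ifs with h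
  · obtain ⟨s, rfl⟩ := Nat.exists_eq_add_of_le h
    have h1 := hpos (p + s)
    rw [Nat.add_sub_cancel_left, poch_add _ (p + s) p]
    rw [poch_add (β + 1) p s] at h1 ⊢
    rw [show ((p + s : ℕ) : ℝ) + α + β + 1 = α + β + 1 + (p + s : ℕ) by ring,
      show β + p + 1 = β + 1 + p by ring]
    have h2 := (mul_ne_zero_iff.1 h1).2
    have h3 := hpos p
    have h4 : (s.factorial : ℝ) ≠ 0 := by positivity
    have h5 : (p.factorial : ℝ) ≠ 0 := by positivity
    field_simp
  · simp

theorem stmt14 (α β : ℝ) (hab : -1 ≤ α + β) (hab' : α + β ≤ 1) (hβ : -1 < β)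
    (k M N : ℕ) (hk : 0 < k)
    (m : ℕ) (b : ℕ → ℝ) (hb0 : ∀ p, m ≤ p → b p = 0)
    (hb : ∀ z : ℝ,
      ∑ l ∈ Finset.Icc (-((M : ℤ) + N)) ((M : ℤ) + N),
        (zchoose (M + N) ((M : ℤ) - k * l) : ℝ) *
          (zchoose (M + N) ((N : ℤ) - k * l) : ℝ) *
          (poch (α + β + 1) l.natAbs / poch (β + 1) l.natAbs) * jacobiShift α β l.natAbs z
      = ∑ p ∈ Finset.range m, b p * z ^ p) :
    ∀ p : ℕ, 1 ≤ p → 0 ≤ b p := by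
  intro p hp
  have hpoly : ∑ l ∈ Finset.Icc (-((M : ℤ) + N)) ((M : ℤ) + N),
        Polynomial.C ((zchoose (M + N) ((M : ℤ) - k * l) : ℝ) *
          (zchoose (M + N) ((N : ℤ) - k * l) : ℝ) *
          (poch (α + β + 1) l.natAbs / poch (β + 1) l.natAbs)) * jacobiShiftPoly α β l.natAbs =
      ∑ p ∈ Finset.range m, Polynomial.monomial p (b p) := by
    refine Polynomial.funext fun z => ?_
    simpa only [Polynomial.eval_finsetSum, Polynomial.eval_mul, Polynomial.eval_C,
      eval_jacobiShiftPoly, Polynomial.eval_monomial] using hb z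
  have hcoeff := congrArg (fun f => f.coeff p) hpoly
  simp only [Polynomial.finsetSum_coeff, Polynomial.coeff_C_mul, Polynomial.coeff_monomial,
    Finset.sum_ite_eq', Finset.mem_range] at hcoeff
  have hbp : (if p < m then b p else 0) = b p := by
    split_ifs with h
    · rfl
    · exact (hb0 p (not_lt.1 h)).symm
  rw [hbp] at hcoeff
  simp only [mul_assoc, coeff_jacobiShiftPoly α hβ] at hcoeff
  have heven : Function.Even fun l : ℤ => (zchoose (M + N) ((M : ℤ) - k * l) : ℝ) *
      ((zchoose (M + N) ((N : ℤ) - k * l) : ℝ) *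
        (binomialCoeff (α + β + 1) p l.natAbs / (p.factorial * (2 ^ p * poch (β + 1) p)))) := by
    intro l
    simp only [Int.natAbs_neg]
    rw [← zchoose_symm _ ((M : ℤ) - k * -l), ← zchoose_symm _ ((N : ℤ) - k * -l)]
    push_cast
    rw [show (M : ℤ) + N - (M - k * -l) = N - k * l by ring,
      show (M : ℤ) + N - (N - k * -l) = M - k * l by ring]
    ring
  have hsum := Finset.sum_Icc_of_even_eq_range heven (M + N)
  push_cast at hsum
  have hzero : binomialCoeff (α + β + 1) p 0 = 0 := by
    rw [binomialCoeff, if_neg (by omega)]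
  rw [hsum] at hcoeff
  simp only [Int.natAbs_natCast, hzero, zero_div, mul_zero, sub_zero] at hcoeff
  rw [← hcoeff]
  have hmain := sum_zchoose_mul_binomialCoeff_nonneg (e := α + β + 1) (by linarith) (by linarith)
    hk M N p
  have hden : 0 ≤ (p.factorial * (2 ^ p * poch (β + 1) p) : ℝ) := by
    have := poch_pos (show 0 < β + 1 by linarith) p
    positivity
  refine nsmul_nonneg ?_ 2
  simpa only [Finset.sum_div, mul_assoc, mul_div_assoc] using div_nonneg hmain hden
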